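/- Let Γ be a basic quasi-hereditary algebra with respect to an ordering of its primitive idempotents, with standard modules Δ₁, …, Δₙ. Then Γ has finite global dimension. -/

import Mathlib

open CategoryTheory Limits

/-- The data of a basic algebra with an ordered complete sequence of primitive
orthogonal idempotents, its Jacobson radical, and the associated projective, simple
and standard modules.  `basic` says that `Γ/rad(Γ) ≅ k × ⋯ × k` (`n` factors). -/
structure QHData (k : Type) [Field k] (Γ : Type) [Ring Γ] (n : ℕ) where
  /-- the complete sequence of primitive orthogonal idempotents -/
  e : Fin n → Γ
  idem : ∀ i, e i * e i = e i
  orth : ∀ i j, i ≠ j → e i * e j = 0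
  complete : ∑ i, e i = 1
  prim : ∀ i, ∀ f g : Γ, f * f = f → g * g = g → f * g = 0 → g * f = 0 →
    f + g = e i → f = 0 ∨ g = 0
  /-- the Jacobson radical (characterized by quasi-regularity) -/
  rad : Ideal Γ
  rad_eq : ∀ x : Γ, x ∈ rad ↔ ∀ y : Γ, IsUnit (1 - y * x)
  /-- `Γ` is basic: `Γ/rad ≅ k^n` -/
  basic : ∃ φ : Γ →+* (Fin n → k), Function.Surjective φ ∧ ∀ x, φ x = 0 ↔ x ∈ rad

namespace QHData

variable {k : Type} [Field k] {Γ : Type} [Ring Γ] {n : ℕ} (D : QHData k Γ n)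

/-- The indecomposable projective module `Πᵢ = Γeᵢ`. -/
def proj (i : Fin n) : Submodule Γ Γ := Submodule.span Γ {D.e i}

/-- `ε_i = e_i + e_{i+1} + ⋯ + e_n` (`0`-based; `eps n = 0`). -/
def eps (i : ℕ) : Γ := ∑ j ∈ Finset.univ.filter (fun j : Fin n => i ≤ (j : ℕ)), D.e j

/-- The kernel of `Πᵢ ↠ Δᵢ`, i.e. `Γ ε_{i+1} Γ ∩ Γeᵢ`. -/
def stdKer (i : Fin n) : Submodule Γ ↥(D.proj i) :=
  Submodule.comap (D.proj i).subtype
    (Submodule.span Γ {y : Γ | ∃ x : Γ, y = D.eps ((i : ℕ) + 1) * x})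

/-- The kernel of `Πᵢ ↠ Σᵢ`, i.e. `rad ∩ Γeᵢ = rad·eᵢ`. -/
def radKer (i : Fin n) : Submodule Γ ↥(D.proj i) :=
  Submodule.comap (D.proj i).subtype D.rad

/-- The standard module `Δᵢ = Γeᵢ / Γε_{i+1}Γeᵢ`, the largest quotient of `Πᵢ` with no
composition factors `Σⱼ`, `j > i`. -/
def std (i : Fin n) : ModuleCat Γ := ModuleCat.of Γ (↥(D.proj i) ⧸ D.stdKer i)

/-- The simple module `Σᵢ`, the top of `Πᵢ`. -/
def simple (i : Fin n) : ModuleCat Γ := ModuleCat.of Γ (↥(D.proj i) ⧸ D.radKer i)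

/-- `Θᵢ`, the kernel of `Πᵢ ↠ Δᵢ` as a module. -/
def theta (i : Fin n) : ModuleCat Γ := ModuleCat.of Γ ↥(D.stdKer i)

/-- `Ξᵢ`, the kernel of `Δᵢ ↠ Σᵢ` as a module. -/
def xi (i : Fin n) : ModuleCat Γ :=
  ModuleCat.of Γ (↥(D.radKer i) ⧸ Submodule.comap (D.radKer i).subtype (D.stdKer i))

end QHData

/-- `FiltBy S M` : the module `M` admits a finite filtration whose successive quotients
are isomorphic to members of `S`. -/
inductive FiltBy {Γ : Type} [Ring Γ] (S : Set (ModuleCat Γ)) : ModuleCat Γ → Prop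
  | zero {M : ModuleCat Γ} (h : Subsingleton M) : FiltBy S M
  | step {M : ModuleCat Γ} (N : Submodule Γ M) (hN : FiltBy S (ModuleCat.of Γ ↥N))
      (hq : ∃ Q ∈ S, Nonempty ((M ⧸ N) ≃ₗ[Γ] Q)) : FiltBy S M

/-- `Γ` (with the given idempotent data) is quasi-hereditary: the kernel of `Δᵢ ↠ Σᵢ`
is filtered by `Σ₁, …, Σ_{i-1}`, and the kernel of `Πᵢ ↠ Δᵢ` is filtered by
`Δ_{i+1}, …, Δₙ`. -/
def QHData.IsQuasiHereditary {k : Type} [Field k] {Γ : Type} [Ring Γ] {n : ℕ}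
    (D : QHData k Γ n) : Prop :=
  (∀ i, FiltBy {Q | ∃ j, j < i ∧ Q = D.simple j} (D.xi i)) ∧
  (∀ i, FiltBy {Q | ∃ j, i < j ∧ Q = D.std j} (D.theta i))

/-- `projDimLE R n M` : the module `M` has projective dimension at most `n`. -/
def projDimLE (R : Type) [Ring R] : ℕ → ModuleCat R → Prop
  | 0, M => Projective M
  | (d + 1), M => ∃ (P : ModuleCat R) (f : P ⟶ M),
      Projective P ∧ Epi f ∧ projDimLE R d (kernel f)

namespace QHProof

/-- Unbundled version of the projective dimension bound. -/
abbrev PD (R : Type) [Ring R] (M : Type) [AddCommGroup M] [Module R M] (d : ℕ) : Prop :=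
  HasProjectiveDimensionLT (ModuleCat.of R M) d

section general

variable {R : Type} [Ring R] {M N L : Type} [AddCommGroup M] [Module R M]
  [AddCommGroup N] [Module R N] [AddCommGroup L] [Module R L]

theorem PD.mono {d d' : ℕ} (h : PD R M d) (hd : d ≤ d') : PD R M d' :=
  hasProjectiveDimensionLT_of_ge _ d d' hd

theorem PD.congr {d : ℕ} (h : PD R M d) (e : M ≃ₗ[R] N) : PD R N d :=
  hasProjectiveDimensionLT_of_iso (LinearEquiv.toModuleIso e) d

theorem shortExact (f : M →ₗ[R] N) (g : N →ₗ[R] L) (hex : Function.Exact f g)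
    (hf : Function.Injective f) (hg : Function.Surjective g) :
    (ModuleCat.shortComplexOfCompEqZero f g hex.linearMap_comp_eq_zero).ShortExact :=
  ModuleCat.shortComplex_shortExact _ hex hf hg

theorem pd_mid {d : ℕ} (f : M →ₗ[R] N) (g : N →ₗ[R] L) (hex : Function.Exact f g)
    (hf : Function.Injective f) (hg : Function.Surjective g) (h1 : PD R M d) (h3 : PD R L d) :
    PD R N d :=
  (shortExact f g hex hf hg).hasProjectiveDimensionLT_X₂ d h1 h3

theorem pd_right {d : ℕ} (f : M →ₗ[R] N) (g : N →ₗ[R] L) (hex : Function.Exact f g)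
    (hf : Function.Injective f) (hg : Function.Surjective g) (h1 : PD R M d)
    (h2 : PD R N (d + 1)) : PD R L (d + 1) :=
  (shortExact f g hex hf hg).hasProjectiveDimensionLT_X₃ d h1 h2

theorem pd_left {d : ℕ} (f : M →ₗ[R] N) (g : N →ₗ[R] L) (hex : Function.Exact f g)
    (hf : Function.Injective f) (hg : Function.Surjective g) (h2 : PD R N d)
    (h3 : PD R L (d + 1)) : PD R M d :=
  (shortExact f g hex hf hg).hasProjectiveDimensionLT_X₁ d h2 h3

theorem pd_of_projective [Module.Projective R M] : PD R M 1 := by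
  have : Projective (ModuleCat.of R M) := (IsProjective.iff_projective M).1 inferInstance
  infer_instance

theorem pd_retract {d : ℕ} (i : M →ₗ[R] N) (r : N →ₗ[R] M) (h : r ∘ₗ i = LinearMap.id)
    (hN : PD R N d) : PD R M d :=
  Retract.hasProjectiveDimensionLT
    (⟨ModuleCat.ofHom i, ModuleCat.ofHom r, by rw [← ModuleCat.ofHom_comp, h]; rfl⟩ :
      Retract (ModuleCat.of R M) (ModuleCat.of R N)) d

theorem pd_zero_iff : PD R M 0 ↔ Subsingleton M := by
  rw [PD, hasProjectiveDimensionLT_zero_iff_isZero]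
  exact ⟨fun h => ModuleCat.subsingleton_of_isZero h,
    fun h => ModuleCat.isZero_of_subsingleton (ModuleCat.of R M)⟩

/-- The kernel of a surjection from a free module. -/
theorem exists_cover (M : Type) [AddCommGroup M] [Module R M] :
    ∃ (P : Type) (_ : AddCommGroup P) (_ : Module R P) (f : P →ₗ[R] M),
      Module.Projective R P ∧ Function.Surjective f :=
  ⟨M →₀ R, inferInstance, inferInstance, Finsupp.linearCombination R id, inferInstance,
    Finsupp.linearCombination_id_surjective R M⟩

theorem pd_dfinsupp {ι : Type} (d : ℕ) : ∀ (X : ι → Type) [∀ i, AddCommGroup (X i)]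
    [∀ i, Module R (X i)], (∀ i, PD R (X i) (d + 1)) → PD R (Π₀ i, X i) (d + 1) := by
  induction d with
  | zero =>
    intro X _ _ h
    have : ∀ i, Module.Projective R (X i) := fun i =>
      (IsProjective.iff_projective (X i)).2 (projective_iff_hasProjectiveDimensionLT_one.2 (h i))
    exact pd_of_projective
  | succ d ih =>
    intro X _ _ h
    choose P i1 i2 f hP hf using fun i => exists_cover (R := R) (X i)
    have hK : ∀ i, PD R (LinearMap.ker (f i)) (d + 1) := fun i =>
      pd_left (LinearMap.ker (f i)).subtype (f i) (f i).exact_subtype_ker_map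
        (Submodule.injective_subtype _) (hf i)
        ((pd_of_projective (R := R) (M := P i)).mono (by omega)) (h i)
    have := ih (fun i => LinearMap.ker (f i)) hK
    refine pd_right (DFinsupp.mapRange.linearMap fun i => (LinearMap.ker (f i)).subtype)
      (DFinsupp.mapRange.linearMap f) ?_ ?_ ?_ this (pd_of_projective.mono (by omega))
    · classical
      rw [LinearMap.exact_iff, DFinsupp.ker_mapRangeLinearMap, DFinsupp.range_mapRangeLinearMap]
      simp
    · exact (DFinsupp.mapRange_injective _ (fun _ => by simp)).2
        fun i => Submodule.injective_subtype _
    · exact (DFinsupp.mapRange_surjective _ (fun _ => by simp)).2 hf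

theorem pd_of_semisimple_family {ι : Type} (d : ℕ) (X : ι → Type) [∀ i, AddCommGroup (X i)]
    [∀ i, Module R (X i)] [∀ i, IsSemisimpleModule R (X i)] (g : ∀ i, X i →ₗ[R] M)
    (hg : ⨆ i, LinearMap.range (g i) = ⊤) (h : ∀ i, PD R (X i) (d + 1)) : PD R M (d + 1) := by
  classical
  let G : (Π₀ i, X i) →ₗ[R] M := DFinsupp.lsum ℕ g
  have hG : Function.Surjective G := by
    rw [← LinearMap.range_eq_top, eq_top_iff, ← hg, iSup_le_iff]
    rintro i _ ⟨x, rfl⟩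
    exact ⟨DFinsupp.single i x, by simp [G]⟩
  obtain ⟨h', hh⟩ := IsSemisimpleModule.lifting_property
    (M := Π₀ i, X i) (N := M) G hG LinearMap.id
  exact pd_retract h' G hh (pd_dfinsupp d _ h)

theorem projDimLE_of_pd (d : ℕ) : ∀ M : ModuleCat R,
    HasProjectiveDimensionLT M (d + 1) → projDimLE R d M := by
  induction d with
  | zero => intro M h; exact projective_iff_hasProjectiveDimensionLT_one.2 h
  | succ d ih =>
    intro M h
    refine ⟨Projective.over M, Projective.π M, inferInstance, inferInstance, ih _ ?_⟩
    have hS : (ShortComplex.mk (kernel.ι (Projective.π M)) (Projective.π M)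
      (kernel.condition _)).ShortExact :=
      { exact := ShortComplex.exact_kernel _
        mono_f := inferInstance
        epi_g := inferInstance }
    exact (hS.hasProjectiveDimensionLT_X₃_iff d (inferInstanceAs (Projective (Projective.over M)))).1 h

theorem filtBy_pd {S : Set (ModuleCat.{0} R)} (hS : ∀ Q ∈ S, ∃ d, HasProjectiveDimensionLT Q d)
    {M : ModuleCat.{0} R} (h : FiltBy S M) : ∃ d, PD R M d := by
  induction h with
  | zero h => exact ⟨0, pd_zero_iff.2 h⟩
  | @step M N hN hq ih =>
    obtain ⟨d, hd⟩ := ih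
    obtain ⟨Q, hQ, ⟨e⟩⟩ := hq
    obtain ⟨d', hd'⟩ := hS Q hQ
    have h3 : PD R (M ⧸ N) d' := PD.congr (M := Q) hd' e.symm
    refine ⟨max d d', pd_mid N.subtype N.mkQ (LinearMap.exact_subtype_mkQ N)
      (Submodule.injective_subtype _) (Submodule.mkQ_surjective _)
      (PD.mono (M := N) hd (le_max_left _ _)) (h3.mono (le_max_right _ _))⟩

end general

section qh

variable {k : Type} [Field k] {Γ : Type} [Ring Γ] {n : ℕ} (D : QHData k Γ n)

theorem mul_e {i : Fin n} {x : Γ} (hx : x ∈ D.proj i) : x * D.e i = x := by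
  obtain ⟨a, rfl⟩ := Submodule.mem_span_singleton.1 hx
  simp [mul_assoc, D.idem]

instance proj_projective (i : Fin n) : Module.Projective Γ (D.proj i) := by
  let s : Γ →ₗ[Γ] D.proj i := (LinearMap.toSpanSingleton Γ Γ (D.e i)).codRestrict _
    (fun c => Submodule.smul_mem _ _ (Submodule.mem_span_singleton_self _))
  refine Module.Projective.of_split (D.proj i).subtype s ?_
  refine LinearMap.ext fun x => Subtype.ext ?_
  exact mul_e D x.2

theorem std_le_rad (i : Fin n) : D.stdKer i ≤ D.radKer i := by
  obtain ⟨φ, -, hφ⟩ := D.basic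
  intro x hx
  change (x : Γ) ∈ Submodule.span Γ _ at hx
  change (x : Γ) ∈ D.rad
  rw [← hφ, ← mul_e D x.2, map_mul]
  generalize (x : Γ) = y at hx
  have heps : D.eps ((i : ℕ) + 1) * D.e i = 0 := by
    rw [QHData.eps, Finset.sum_mul]
    refine Finset.sum_eq_zero fun j hj => D.orth j i ?_
    rintro rfl
    simp at hj
  have heps' : φ (D.eps ((i : ℕ) + 1)) * φ (D.e i) = 0 := by rw [← map_mul, heps, map_zero]
  induction hx using Submodule.span_induction with
  | mem y hy =>
    obtain ⟨z, rfl⟩ := hy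
    rw [map_mul, mul_right_comm, heps', zero_mul]
  | zero => simp
  | add y z _ _ hy hz => rw [map_add, add_mul, hy, hz, add_zero]
  | smul a y _ hy => rw [smul_eq_mul, map_mul, mul_assoc, hy, mul_zero]

theorem std_pd (hD : D.IsQuasiHereditary) (i : Fin n) :
    ∃ d, PD Γ (D.proj i ⧸ D.stdKer i) d := by
  induction i using WellFoundedGT.induction with
  | ind i ih =>
    obtain ⟨d, hd⟩ := filtBy_pd (by rintro Q ⟨j, hj, rfl⟩; exact ih j hj) (hD.2 i)
    exact ⟨d + 1, pd_right (D.stdKer i).subtype (D.stdKer i).mkQ (LinearMap.exact_subtype_mkQ _)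
      (Submodule.injective_subtype _) (Submodule.mkQ_surjective _)
      hd (pd_of_projective.mono (by omega))⟩

theorem simple_pd (hD : D.IsQuasiHereditary) (i : Fin n) :
    ∃ d, PD Γ (D.proj i ⧸ D.radKer i) d := by
  induction i using WellFoundedLT.induction with
  | ind i ih =>
    obtain ⟨d, hd⟩ := filtBy_pd (by rintro Q ⟨j, hj, rfl⟩; exact ih j hj) (hD.1 i)
    obtain ⟨d', hd'⟩ := std_pd D hD i
    have hd2 : PD Γ (D.radKer i ⧸ Submodule.comap (D.radKer i).subtype (D.stdKer i)) d := hd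
    refine ⟨max d d' + 1, pd_right
      (Submodule.mapQ (Submodule.comap (D.radKer i).subtype (D.stdKer i)) (D.stdKer i)
        (D.radKer i).subtype le_rfl)
      (Submodule.factor (std_le_rad D i)) ?_ ?_ ?_ (hd2.mono (le_max_left _ _))
      (hd'.mono ((le_max_right _ _).trans (Nat.le_succ _)))⟩
    · intro y
      obtain ⟨y, rfl⟩ := Submodule.mkQ_surjective _ y
      have key : Submodule.factor (std_le_rad D i) ((D.stdKer i).mkQ y) = 0 ↔ y ∈ D.radKer i :=
        Submodule.Quotient.mk_eq_zero _
      rw [key]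
      constructor
      · intro hy
        exact ⟨Submodule.Quotient.mk ⟨y, hy⟩, rfl⟩
      · rintro ⟨z, hz⟩
        obtain ⟨z, rfl⟩ := Submodule.mkQ_surjective _ z
        simp only [Submodule.mkQ_apply, Submodule.mapQ_apply] at hz
        rw [Submodule.Quotient.eq] at hz
        have := (D.radKer i).sub_mem z.2 (std_le_rad D i hz)
        simpa using this
    · rw [← LinearMap.ker_eq_bot, Submodule.ker_mapQ]
      simp
    · exact Submodule.factor_surjective _

theorem rad_eq_jacobson : D.rad = Ring.jacobson Γ := by
  apply le_antisymm
  · intro x hx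
    rw [← Ideal.jacobson_bot, Ideal.mem_jacobson_iff]
    intro y
    obtain ⟨u, hu⟩ := (D.rad_eq x).1 hx (-y)
    refine ⟨(u⁻¹ : Γˣ), ?_⟩
    have : ((u⁻¹ : Γˣ) : Γ) * (1 - -y * x) = 1 := by rw [← hu]; simp
    rw [Ideal.mem_bot, ← this]
    noncomm_ring
  · obtain ⟨φ, hs, hφ⟩ := D.basic
    intro x hx
    rw [← hφ]
    have : RingHomSurjective φ := ⟨hs⟩
    have h := Ring.le_comap_jacobson φ hx
    have h0 : Ring.jacobson (Fin n → k) = ⊥ :=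
      IsArtinianRing.isSemisimpleRing_iff_jacobson.1 inferInstance
    rw [h0] at h
    simpa using h

theorem pd_semisimple [IsArtinianRing Γ] (d : ℕ)
    (hd : ∀ i, PD Γ (D.proj i ⧸ D.radKer i) (d + 1)) (M : Type) [AddCommGroup M] [Module Γ M]
    (hM : Module.IsTorsionBySet Γ M (Ring.jacobson Γ)) [IsSemisimpleModule Γ M] :
    PD Γ M (d + 1) := by
  classical
  have hss : IsSemisimpleModule Γ (Γ ⧸ D.rad) := by
    rw [rad_eq_jacobson D]
    exact (IsArtinian.isSemisimpleModule_iff_jacobson Γ _).2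
      (Module.jacobson_quotient_jacobson Γ Γ)
  have hs : ∀ i, IsSemisimpleModule Γ (D.proj i ⧸ D.radKer i) := fun i =>
    IsSemisimpleModule.of_injective
      (Submodule.mapQ (D.radKer i) D.rad (D.proj i).subtype (fun _ hx => hx)) (by
        rw [injective_iff_map_eq_zero]
        intro y hy
        obtain ⟨y, rfl⟩ := Submodule.mkQ_surjective _ y
        exact (Submodule.Quotient.mk_eq_zero _).2 ((Submodule.Quotient.mk_eq_zero D.rad).1 hy))
  let g : ∀ p : M × Fin n, (D.proj p.2 ⧸ D.radKer p.2) →ₗ[Γ] M := fun p =>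
    (D.radKer p.2).liftQ ((LinearMap.toSpanSingleton Γ M p.1) ∘ₗ (D.proj p.2).subtype) (by
      intro x hx
      have hx' : (x : Γ) ∈ Ring.jacobson Γ := by
        rw [← rad_eq_jacobson D]; exact hx
      exact @hM p.1 ⟨(x : Γ), hx'⟩)
  refine pd_of_semisimple_family d (fun p : M × Fin n => (D.proj p.2 ⧸ D.radKer p.2)) g ?_
    fun p => hd p.2
  rw [eq_top_iff]
  intro m _
  rw [← one_smul Γ m, ← D.complete, Finset.sum_smul]
  refine Submodule.sum_mem _ fun i _ => ?_
  refine Submodule.mem_iSup_of_mem (m, i) ⟨Submodule.Quotient.mk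
    ⟨D.e i, Submodule.mem_span_singleton_self _⟩, rfl⟩

end qh

end QHProof

/-- A basic quasi-hereditary algebra has finite global dimension. -/
theorem finite_global_dimension_of_quasiHereditary
    (k : Type) [Field k] (Γ : Type) [Ring Γ] [Algebra k Γ] [FiniteDimensional k Γ]
    {n : ℕ} (D : QHData k Γ n) (hD : D.IsQuasiHereditary) :
    ∃ d : ℕ, ∀ M : ModuleCat Γ, projDimLE Γ d M := by
  have : IsArtinianRing Γ := IsArtinianRing.of_finite k Γ
  choose f hf using QHProof.simple_pd D hD
  have hd : ∀ i, QHProof.PD Γ (D.proj i ⧸ D.radKer i) ((∑ i, f i) + 1) := fun i =>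
    (hf i).mono ((Finset.single_le_sum (fun _ _ => Nat.zero_le _)
      (Finset.mem_univ i)).trans (Nat.le_succ _))
  refine ⟨∑ i, f i, fun M => QHProof.projDimLE_of_pd _ M ?_⟩
  exact IsSemiprimaryRing.induction Γ Γ M
    (P := fun M [AddCommGroup M] [Module Γ M] [Module Γ M] => QHProof.PD Γ M ((∑ i, f i) + 1))
    (fun M _ _ _ _ _ hM => QHProof.pd_semisimple D _ hd M hM)
    (fun M _ _ _ _ h1 h2 => QHProof.pd_mid (Submodule.subtype _) (Submodule.mkQ _)
      (LinearMap.exact_subtype_mkQ _)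
      (Submodule.injective_subtype _) (Submodule.mkQ_surjective _) h1 h2)
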